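/- Let X be an n-poised set and let ℓ be a 2-node line of X. Then |X_ℓ| = 1 or |X_ℓ| = 0, i.e., at most one node of X uses the line ℓ. -/

import Mathlib

open MvPolynomial

/-- Bivariate real polynomials. -/
abbrev Poly2 : Type := MvPolynomial (Fin 2) ℝ

/-- Evaluation of a bivariate polynomial at a point of `ℝ²`. -/
noncomputable def evalPt (p : Poly2) (A : ℝ × ℝ) : ℝ :=
  MvPolynomial.eval (fun i => if i = 0 then A.1 else A.2) p

/-- `X` is an `n`-poised set: it has `(n+2 choose 2)` nodes and the only polynomial of
total degree at most `n` vanishing on all of `X` is the zero polynomial. -/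
def IsPoised (n : ℕ) (X : Finset (ℝ × ℝ)) : Prop :=
  X.card = (n + 2).choose 2 ∧
    ∀ p : Poly2, p.totalDegree ≤ n → (∀ A ∈ X, evalPt p A = 0) → p = 0

/-- `p` is an `n`-fundamental polynomial of the node `A` with respect to `X`. -/
def IsFund (n : ℕ) (X : Finset (ℝ × ℝ)) (A : ℝ × ℝ) (p : Poly2) : Prop :=
  p.totalDegree ≤ n ∧ evalPt p A = 1 ∧ ∀ B ∈ X, B ≠ A → evalPt p B = 0

/-- `X` is a `GC_n` set: `n`-poised and each node has a fundamental polynomial which is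
a product of `n` polynomials of degree 1. -/
def IsGC (n : ℕ) (X : Finset (ℝ × ℝ)) : Prop :=
  IsPoised n X ∧
    ∀ A ∈ X, ∃ p : Poly2, IsFund n X A p ∧
      ∃ f : Fin n → Poly2, (∀ i, (f i).totalDegree = 1) ∧ p = ∏ i, f i

/-- The nodes of `X` lying on the zero set of `ℓ`. -/
noncomputable def nodesOn (X : Finset (ℝ × ℝ)) (ℓ : Poly2) : Finset (ℝ × ℝ) :=
  @Finset.filter _ (fun A => evalPt ℓ A = 0) (Classical.decPred _) X

/-- `ℓ` is a `k`-node line of `X`: it has degree exactly 1 and passes through exactly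
`k` nodes of `X`. -/
def IsKNodeLine (X : Finset (ℝ × ℝ)) (ℓ : Poly2) (k : ℕ) : Prop :=
  ℓ.totalDegree = 1 ∧ (nodesOn X ℓ).card = k

/-- A maximal line of an `n`-poised set: an `(n+1)`-node line. -/
def IsMaximalLine (n : ℕ) (X : Finset (ℝ × ℝ)) (ℓ : Poly2) : Prop :=
  IsKNodeLine X ℓ (n + 1)

/-- The zero set of a polynomial, i.e. the line it determines when it has degree 1. -/
def zeroSet (ℓ : Poly2) : Set (ℝ × ℝ) := {A | evalPt ℓ A = 0}

/-- `μ(X)`: the number of maximal lines (as subsets of the plane) of `X`. -/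
noncomputable def mu (n : ℕ) (X : Finset (ℝ × ℝ)) : ℕ :=
  {L : Set (ℝ × ℝ) | ∃ ℓ : Poly2, IsMaximalLine n X ℓ ∧ L = zeroSet ℓ}.ncard

/-- The node `A` of `X` uses the line `ℓ`: `ℓ` divides a fundamental polynomial of `A`. -/
def Uses (n : ℕ) (X : Finset (ℝ × ℝ)) (ℓ : Poly2) (A : ℝ × ℝ) : Prop :=
  ∃ p : Poly2, IsFund n X A p ∧ ℓ ∣ p

/-- `X_ℓ`: the set of nodes of `X` using the line `ℓ`. -/
noncomputable def usesSet (n : ℕ) (X : Finset (ℝ × ℝ)) (ℓ : Poly2) : Finset (ℝ × ℝ) :=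
  @Finset.filter _ (Uses n X ℓ) (Classical.decPred _) X

/-- The Gasca–Maeztu conjecture for degree `m`: every `GC_m` set has a maximal line. -/
def GM (m : ℕ) : Prop :=
  ∀ Y : Finset (ℝ × ℝ), IsGC m Y → ∃ lam : Poly2, IsMaximalLine m Y lam

/-- The polynomial `a (x - P₁) + b (y - P₂)`. -/
noncomputable def linThrough (P : ℝ × ℝ) (a b : ℝ) : Poly2 :=
  MvPolynomial.C a * (X 0 - MvPolynomial.C P.1) + MvPolynomial.C b * (X 1 - MvPolynomial.C P.2)

theorem evalPt_lin (P Q : ℝ × ℝ) (a b : ℝ) :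
    evalPt (linThrough P a b) Q = a * (Q.1 - P.1) + b * (Q.2 - P.2) := by
  simp [evalPt, linThrough]

theorem evalPt_mul_aux (p q : Poly2) (A : ℝ × ℝ) : evalPt (p * q) A = evalPt p A * evalPt q A := by
  simp [evalPt]

theorem evalPt_add_aux (p q : Poly2) (A : ℝ × ℝ) : evalPt (p + q) A = evalPt p A + evalPt q A := by
  simp [evalPt]

theorem evalPt_C_aux (c : ℝ) (A : ℝ × ℝ) : evalPt (MvPolynomial.C c) A = c := by
  simp [evalPt]

theorem deg_lin (P : ℝ × ℝ) (a b : ℝ) : (linThrough P a b).totalDegree ≤ 1 := by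
  have h : ∀ (i : Fin 2) (c e : ℝ),
      (MvPolynomial.C c * (X i - MvPolynomial.C e) : Poly2).totalDegree ≤ 1 := by
    intro i c e
    refine (totalDegree_mul _ _).trans ?_
    have h1 := totalDegree_sub (X i : Poly2) (MvPolynomial.C e)
    simp only [totalDegree_X, totalDegree_C] at h1 ⊢
    omega
  exact (totalDegree_add _ _).trans (max_le (h _ _ _) (h _ _ _))

/-- Restriction of a polynomial to the line through `A` and `B`. -/
noncomputable def restr (A B : ℝ × ℝ) : Poly2 →ₐ[ℝ] Polynomial ℝ :=
  MvPolynomial.aeval (fun i : Fin 2 =>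
    if i = 0 then Polynomial.C A.1 + Polynomial.X * Polynomial.C (B.1 - A.1)
    else Polynomial.C A.2 + Polynomial.X * Polynomial.C (B.2 - A.2))

theorem eval_restr (A B : ℝ × ℝ) (p : Poly2) (t : ℝ) :
    (restr A B p).eval t = evalPt p (A.1 + t * (B.1 - A.1), A.2 + t * (B.2 - A.2)) := by
  induction p using MvPolynomial.induction_on with
  | C a => simp [restr, evalPt]
  | add p q hp hq => rw [map_add, Polynomial.eval_add, hp, hq, evalPt_add_aux]
  | mul_X p i hp =>
    rw [map_mul, Polynomial.eval_mul, hp, evalPt_mul_aux]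
    congr 1
    fin_cases i <;> simp [restr, evalPt]

theorem exists_sol (u v w u2 v2 w2 : ℝ) : ∃ a b c : ℝ, ¬ (a = 0 ∧ b = 0 ∧ c = 0) ∧
    a * u + b * v + c * w = 0 ∧ a * u2 + b * v2 + c * w2 = 0 := by
  have := LinearMap.ker_ne_bot_of_finrank_lt
    (f := Matrix.toLin' !![u, v, w; u2, v2, w2]) (by simp)
  obtain ⟨x, hx, hx0⟩ := (Submodule.ne_bot_iff _).1 this
  rw [LinearMap.mem_ker, Matrix.toLin'_apply] at hx
  refine ⟨x 0, x 1, x 2, ?_, ?_, ?_⟩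
  · rintro ⟨h0, h1, h2⟩
    apply hx0
    ext i
    fin_cases i <;> simpa
  · have := congrFun hx 0
    simp [Matrix.mulVec, dotProduct, Fin.sum_univ_three] at this
    linarith
  · have := congrFun hx 1
    simp [Matrix.mulVec, dotProduct, Fin.sum_univ_three] at this
    linarith

theorem uses_aux (n : ℕ) (X : Finset (ℝ × ℝ)) (ℓ : Poly2) (hd : ℓ.totalDegree = 1)
    (A : ℝ × ℝ) (h : Uses n X ℓ A) :
    ∃ q : Poly2, q.totalDegree + 1 ≤ n ∧ evalPt q A ≠ 0 ∧ evalPt ℓ A ≠ 0 ∧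
      ∀ B ∈ X, B ≠ A → evalPt ℓ B ≠ 0 → evalPt q B = 0 := by
  obtain ⟨p, ⟨hp1, hp2, hp3⟩, q, rfl⟩ := h
  rw [evalPt_mul_aux] at hp2
  have hl : ℓ ≠ 0 := by rintro rfl; simp at hd
  have hq : q ≠ 0 := by rintro rfl; simp [evalPt] at hp2
  refine ⟨q, ?_, ?_, ?_, ?_⟩
  · rw [totalDegree_mul_of_isDomain hl hq] at hp1
    omega
  · intro h; simp [h] at hp2
  · intro h; simp [h] at hp2
  · intro B hB hBA hlB
    have := hp3 B hB hBA
    rw [evalPt_mul_aux] at this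
    exact (mul_eq_zero.1 this).resolve_left hlB

theorem uses_unique (n : ℕ) (X : Finset (ℝ × ℝ)) (hX : IsPoised n X)
    (ℓ : Poly2) (hℓ : IsKNodeLine X ℓ 2) (A B : ℝ × ℝ) (hA : A ∈ X) (hB : B ∈ X)
    (uA : Uses n X ℓ A) (uB : Uses n X ℓ B) : A = B := by
  by_contra hAB
  obtain ⟨hd, hc⟩ := hℓ
  obtain ⟨E, G, -, hEG⟩ := Finset.card_eq_two.1 hc
  have hon : ∀ P ∈ X, evalPt ℓ P = 0 → P = E ∨ P = G := by
    intro P hP h0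
    have : P ∈ nodesOn X ℓ := by
      unfold nodesOn
      simp [hP, h0]
    rw [hEG] at this
    simpa using this
  obtain ⟨q, dq, qA, lA, hq⟩ := uses_aux n X ℓ hd A uA
  obtain ⟨r, dr, rB, lB, hr⟩ := uses_aux n X ℓ hd B uB
  have qB : evalPt q B = 0 := hq B hB (Ne.symm hAB) lB
  have rA : evalPt r A = 0 := hr A hA hAB lA
  set d1 := B.1 - A.1 with hd1
  set d2 := B.2 - A.2 with hd2
  have hdd : d1 ^ 2 + d2 ^ 2 ≠ 0 := by
    intro h
    apply hAB
    have h1 : d1 = 0 := by nlinarith [sq_nonneg d1, sq_nonneg d2]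
    have h2 : d2 = 0 := by nlinarith [sq_nonneg d1, sq_nonneg d2]
    ext <;> linarith
  obtain ⟨a, b, c, hne, hE, hG⟩ := exists_sol
    ((E.1 - A.1) * evalPt q E) ((E.2 - A.2) * evalPt q E)
    ((d2 * (E.1 - A.1) + (-d1) * (E.2 - A.2)) * evalPt r E)
    ((G.1 - A.1) * evalPt q G) ((G.2 - A.2) * evalPt q G)
    ((d2 * (G.1 - A.1) + (-d1) * (G.2 - A.2)) * evalPt r G)
  set L := linThrough A d2 (-d1) with hL
  have hF : linThrough A a b * q + MvPolynomial.C c * (L * r) = 0 := by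
    apply hX.2
    · refine (totalDegree_add _ _).trans (max_le ?_ ?_)
      · have := totalDegree_mul (linThrough A a b) q
        have := deg_lin A a b
        omega
      · have := totalDegree_mul (MvPolynomial.C c) (L * r)
        have := totalDegree_mul L r
        have : L.totalDegree ≤ 1 := deg_lin A d2 (-d1)
        simp only [totalDegree_C] at *
        omega
    · intro P hP
      simp only [evalPt_add_aux, evalPt_mul_aux, evalPt_C_aux, hL, evalPt_lin]
      by_cases hPA : P = A
      · subst hPA; simp
      by_cases hPB : P = B
      · subst hPB; rw [qB, ← hd1, ← hd2]; ring
      by_cases hl : evalPt ℓ P = 0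
      · rcases hon P hP hl with rfl | rfl
        · linarith
        · linarith
      · rw [hq P hP hPA hl, hr P hP hPB hl]; ring
  have hLr : restr A B L = 0 := by
    apply Polynomial.funext
    intro t
    rw [eval_restr, hL, evalPt_lin, ← hd1, ← hd2]
    simp; ring
  have hFr := congrArg (restr A B) hF
  simp only [map_add, map_mul, hLr, zero_mul, mul_zero, add_zero, map_zero] at hFr
  have hm : a * d1 + b * d2 = 0 := by
    rcases mul_eq_zero.1 hFr with h | h
    · have := congrArg (Polynomial.eval 1) h
      rw [eval_restr, evalPt_lin] at this
      simpa using this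
    · have := congrArg (Polynomial.eval 0) h
      rw [eval_restr] at this
      exact absurd (by simpa using this) qA
  obtain ⟨s, hs1, hs2⟩ : ∃ s, a = s * d2 ∧ b = s * (-d1) := by
    refine ⟨(a * d2 - b * d1) / (d1 ^ 2 + d2 ^ 2), ?_, ?_⟩
    · field_simp; linear_combination d1 * hm
    · field_simp; linear_combination d2 * hm
  have hLs : linThrough A a b = MvPolynomial.C s * L := by
    rw [hL, linThrough, linThrough, hs1, hs2]
    simp only [map_mul]; ring
  have hL0 : L ≠ 0 := by
    intro h
    have := evalPt_lin A (A.1 + d2, A.2 - d1) d2 (-d1)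
    rw [← hL, h] at this
    simp [evalPt] at this
    apply hdd
    linarith
  have hz : MvPolynomial.C s * q + MvPolynomial.C c * r = 0 := by
    have : L * (MvPolynomial.C s * q + MvPolynomial.C c * r) = 0 := by
      rw [← hF, hLs]; ring
    exact (mul_eq_zero.1 this).resolve_left hL0
  have z : ∀ P, s * evalPt q P + c * evalPt r P = 0 := by
    intro P
    have := congrArg (fun p => evalPt p P) hz
    simpa [evalPt_add_aux, evalPt_mul_aux, evalPt_C_aux, show evalPt 0 P = 0 by simp [evalPt]] using this
  have hs : s = 0 := by
    have := z A
    rw [rA] at this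
    simpa [qA] using this
  have hc0 : c = 0 := by
    have := z B
    rw [qB] at this
    simpa [rB] using this
  apply hne
  simp [hs1, hs2, hs, hc0]

/-- For an `n`-poised set `X` and a `2`-node line `ℓ`,
`|X_ℓ| = 1` or `|X_ℓ| = 0`. -/
theorem stmt_7 (n : ℕ) (X : Finset (ℝ × ℝ)) (hX : IsPoised n X)
    (ℓ : Poly2) (hℓ : IsKNodeLine X ℓ 2) :
    (usesSet n X ℓ).card = 1 ∨ (usesSet n X ℓ).card = 0 := by
  have h : (usesSet n X ℓ).card ≤ 1 := by
    rw [Finset.card_le_one]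
    intro A hA B hB
    unfold usesSet at hA hB
    replace hA := (@Finset.mem_filter _ _ (Classical.decPred _) _ _).1 hA
    replace hB := (@Finset.mem_filter _ _ (Classical.decPred _) _ _).1 hB
    exact uses_unique n X hX ℓ hℓ A B hA.1 hB.1 hA.2 hB.2
  omega
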